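/- arXiv:2312.01100 — 6 statements merged into one kernel-verified Lean document; each statement's English description precedes it below -/
import Mathlib

section
/- Let σ > 0, r_c > 0, r_j > 0 be real numbers and let α = (α₁, α₂) ∈ ℝ² (representing a complex gain). Let Z_j = (A_j, B_j) and Z_c = (A_c, B_c) where A_j, B_j, A_c, B_c are independent real Gaussian random variables with A_j, B_j ~ N(0, σ²/(2 r_j)) and A_c, B_c ~ N(0, σ²/(2 r_c)). Then the probability P( A_j² + B_j² > (α₁ + A_c)² + (α₂ + B_c)² ) equals (r_c/(r_c + r_j)) · exp( −(r_c r_j/(r_c + r_j)) · ρ ), where ρ = (α₁² + α₂²)/σ². -/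
open MeasureTheory ProbabilityTheory

open scoped NNReal ENNReal

/-- The Rayleigh tail integral. -/
lemma setLIntegral_Ioi_rayleigh {v : ℝ} (hv : 0 < v) {a : ℝ} (ha : 0 ≤ a) :
    ∫⁻ r in Set.Ioi a, ENNReal.ofReal (r / v * Real.exp (-r ^ 2 / (2 * v))) =
      ENNReal.ofReal (Real.exp (-a ^ 2 / (2 * v))) := by
  have hderiv : ∀ r ∈ Set.Ici a, HasDerivAt (fun r : ℝ => -Real.exp (-r ^ 2 / (2 * v)))
      (r / v * Real.exp (-r ^ 2 / (2 * v))) r := by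
    intro r _
    have h := (((hasDerivAt_pow 2 r).fun_neg.div_const (2 * v)).exp).fun_neg
    refine h.congr_deriv ?_
    field_simp
    simp [mul_comm]
  have hnonneg : ∀ r ∈ Set.Ioi a, 0 ≤ r / v * Real.exp (-r ^ 2 / (2 * v)) := by
    intro r hr
    have : 0 < r := ha.trans_lt hr
    positivity
  have hlim : Filter.Tendsto (fun r : ℝ => -Real.exp (-r ^ 2 / (2 * v))) Filter.atTop
      (nhds 0) := by
    rw [← neg_zero]
    refine (Real.tendsto_exp_atBot.comp ?_).neg
    refine Filter.Tendsto.atBot_div_const (by positivity) ?_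
    exact Filter.tendsto_neg_atTop_atBot.comp (Filter.tendsto_pow_atTop two_ne_zero)
  rw [← ofReal_integral_eq_lintegral_ofReal
    (integrableOn_Ioi_deriv_of_nonneg' hderiv hnonneg hlim)
    ((ae_restrict_iff' measurableSet_Ioi).2 (.of_forall hnonneg)),
    integral_Ioi_of_hasDerivAt_of_nonneg' hderiv hnonneg hlim]
  simp

/-- The squared norm of a centered isotropic Gaussian vector in the plane is exponentially
distributed. -/
lemma gaussianReal_prod_sq_add_sq_gt {v : ℝ≥0} (hv : v ≠ 0) {s : ℝ} (hs : 0 ≤ s) :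
    ((gaussianReal 0 v).prod (gaussianReal 0 v)) {p : ℝ × ℝ | s < p.1 ^ 2 + p.2 ^ 2} =
      ENNReal.ofReal (Real.exp (-s / (2 * v))) := by
  have hS : MeasurableSet {p : ℝ × ℝ | s < p.1 ^ 2 + p.2 ^ 2} :=
    measurableSet_lt measurable_const (by fun_prop)
  have hv' : (0 : ℝ) < v := by positivity
  have hpolar : Set.EqOn
      (fun p : ℝ × ℝ => ENNReal.ofReal p.1 •
        ({p : ℝ × ℝ | s < p.1 ^ 2 + p.2 ^ 2}.indicator
          fun z => gaussianPDF 0 v z.1 * gaussianPDF 0 v z.2) (polarCoord.symm p))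
      (fun p => (Set.Ioi √s).indicator
          (fun r => ENNReal.ofReal (r / v * Real.exp (-r ^ 2 / (2 * v)))) p.1 *
        ENNReal.ofReal (1 / (2 * Real.pi)))
      polarCoord.target := by
    rintro ⟨r, θ⟩ ⟨hr, -⟩
    have hr : 0 < r := hr
    have hnorm : (r * Real.cos θ) ^ 2 + (r * Real.sin θ) ^ 2 = r ^ 2 := by
      linear_combination r ^ 2 * Real.sin_sq_add_cos_sq θ
    simp only [polarCoord_symm_apply, smul_eq_mul, Set.indicator_apply, Set.mem_ofPred_eq, hnorm,
      Set.mem_Ioi, Real.sqrt_lt' hr]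
    split_ifs
    · simp only [gaussianPDF, gaussianPDFReal, sub_zero]
      rw [← ENNReal.ofReal_mul (by positivity), ← ENNReal.ofReal_mul (by positivity),
        ← ENNReal.ofReal_mul (by positivity), mul_mul_mul_comm, ← Real.exp_add, ← mul_inv,
        Real.mul_self_sqrt (by positivity), ← add_div, ← neg_add, hnorm]
      congr 1
      field_simp
    · simp
  rw [gaussianReal_of_var_ne_zero 0 hv,
    prod_withDensity (measurable_gaussianPDF 0 v) (measurable_gaussianPDF 0 v),
    withDensity_apply _ hS, ← lintegral_indicator hS, ← Measure.volume_eq_prod,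
    ← lintegral_comp_polarCoord_symm,
    setLIntegral_congr_fun polarCoord.open_target.measurableSet hpolar, polarCoord_target,
    Measure.volume_eq_prod, ← Measure.prod_restrict,
    lintegral_prod_mul (Measurable.aemeasurable (Measurable.indicator (by fun_prop)
      measurableSet_Ioi)) aemeasurable_const, lintegral_indicator measurableSet_Ioi,
    Measure.restrict_restrict measurableSet_Ioi,
    Set.inter_eq_left.2 (Set.Ioi_subset_Ioi (Real.sqrt_nonneg s)),
    setLIntegral_Ioi_rayleigh hv' (Real.sqrt_nonneg s), Real.sq_sqrt hs, lintegral_const,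
    Measure.restrict_apply_univ, Real.volume_Ioo, ← ENNReal.ofReal_mul (by positivity),
    ← ENNReal.ofReal_mul (by positivity)]
  congr 1
  field_simp
  ring

/-- The Laplace transform of the square of a shifted centered Gaussian variable. -/
lemma lintegral_exp_neg_mul_sq_gaussianReal {v : ℝ≥0} (hv : v ≠ 0) {b : ℝ} (hb : 0 ≤ b)
    (α : ℝ) :
    ∫⁻ x, ENNReal.ofReal (Real.exp (-b * (α + x) ^ 2)) ∂gaussianReal 0 v =
      ENNReal.ofReal ((√(1 + 2 * b * v))⁻¹ * Real.exp (-b * α ^ 2 / (1 + 2 * b * v))) := by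
  have hv' : (0 : ℝ) < v := by positivity
  lift b to ℝ≥0 using hb
  have hw : v / (1 + 2 * b * v) ≠ 0 := by positivity
  have hd : (0 : ℝ) < 1 + 2 * b * v := by positivity
  have hpdf : ∀ x, gaussianPDF 0 v x * ENNReal.ofReal (Real.exp (-b * (α + x) ^ 2)) =
      ENNReal.ofReal ((√(1 + 2 * b * v))⁻¹ * Real.exp (-b * α ^ 2 / (1 + 2 * b * v))) *
        gaussianPDF (-(2 * b * v * α) / (1 + 2 * b * v)) (v / (1 + 2 * b * v)) x := by
    intro x
    simp only [gaussianPDF, gaussianPDFReal]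
    rw [← ENNReal.ofReal_mul (by positivity), ← ENNReal.ofReal_mul (by positivity), mul_assoc,
      ← Real.exp_add, mul_mul_mul_comm, ← Real.exp_add, ← mul_inv, ← Real.sqrt_mul hd.le]
    push_cast
    congr 2
    · congr 2
      field_simp
    · congr 1
      field_simp
      ring
  rw [gaussianReal_of_var_ne_zero 0 hv,
    lintegral_withDensity_eq_lintegral_mul _ (measurable_gaussianPDF 0 v) (by fun_prop)]
  simp only [Pi.mul_apply, hpdf]
  rw [lintegral_const_mul _ (measurable_gaussianPDF _ _), lintegral_gaussianPDF_eq_one _ hw,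
    mul_one]

/-- Lemma 1 of the paper: the pair-wise miss-determination probability.
`Z_j ~ CN(0, σ²/r_j)` and `Z_c ~ CN(0, σ²/r_c)` are modeled as pairs of independent
real Gaussians with variance `σ²/(2 r_j)` resp. `σ²/(2 r_c)` each; the probability is
taken w.r.t. the product of the four Gaussian measures. -/
theorem pairwise_miss_determination_prob
    (σ rc rj α₁ α₂ : ℝ) (hσ : 0 < σ) (hrc : 0 < rc) (hrj : 0 < rj) :
    (Measure.prod (gaussianReal 0 ((σ ^ 2 / (2 * rj)).toNNReal))
      (Measure.prod (gaussianReal 0 ((σ ^ 2 / (2 * rj)).toNNReal))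
        (Measure.prod (gaussianReal 0 ((σ ^ 2 / (2 * rc)).toNNReal))
          (gaussianReal 0 ((σ ^ 2 / (2 * rc)).toNNReal)))))
      {p : ℝ × ℝ × ℝ × ℝ |
        p.1 ^ 2 + p.2.1 ^ 2 > (α₁ + p.2.2.1) ^ 2 + (α₂ + p.2.2.2) ^ 2}
    = ENNReal.ofReal
        ((rc / (rc + rj)) *
          Real.exp (-(rc * rj / (rc + rj)) * ((α₁ ^ 2 + α₂ ^ 2) / σ ^ 2))) := by
  have hj : (σ ^ 2 / (2 * rj)).toNNReal ≠ 0 := (Real.toNNReal_pos.2 (by positivity)).ne'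
  have hc : (σ ^ 2 / (2 * rc)).toNNReal ≠ 0 := (Real.toNNReal_pos.2 (by positivity)).ne'
  have hjc : ((σ ^ 2 / (2 * rj)).toNNReal : ℝ) = σ ^ 2 / (2 * rj) :=
    Real.coe_toNNReal _ (by positivity)
  have hcc : ((σ ^ 2 / (2 * rc)).toNNReal : ℝ) = σ ^ 2 / (2 * rc) :=
    Real.coe_toNNReal _ (by positivity)
  have hb : 0 ≤ rj / σ ^ 2 := by positivity
  have hS : MeasurableSet {p : ℝ × ℝ × ℝ × ℝ |
      p.1 ^ 2 + p.2.1 ^ 2 > (α₁ + p.2.2.1) ^ 2 + (α₂ + p.2.2.2) ^ 2} :=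
    measurableSet_lt (by fun_prop) (by fun_prop)
  have hsplit : ∀ q : ℝ × ℝ,
      ENNReal.ofReal (Real.exp (-((α₁ + q.1) ^ 2 + (α₂ + q.2) ^ 2) / (2 * (σ ^ 2 / (2 * rj))))) =
        ENNReal.ofReal (Real.exp (-(rj / σ ^ 2) * (α₁ + q.1) ^ 2)) *
          ENNReal.ofReal (Real.exp (-(rj / σ ^ 2) * (α₂ + q.2) ^ 2)) := by
    intro q
    rw [← ENNReal.ofReal_mul (Real.exp_nonneg _), ← Real.exp_add]
    congr 2
    field_simp
    ring
  have hd : 1 + 2 * (rj / σ ^ 2) * (σ ^ 2 / (2 * rc)) = (rc + rj) / rc := by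
    field_simp
  rw [← (measurePreserving_prodAssoc _ _ _).measure_preimage hS.nullMeasurableSet,
    Measure.prod_apply_symm (MeasurableEquiv.prodAssoc.measurable hS)]
  have hinner : ∀ q : ℝ × ℝ, ((gaussianReal 0 ((σ ^ 2 / (2 * rj)).toNNReal)).prod
      (gaussianReal 0 ((σ ^ 2 / (2 * rj)).toNNReal)))
      ((fun x => (x, q)) ⁻¹' (MeasurableEquiv.prodAssoc ⁻¹' {p : ℝ × ℝ × ℝ × ℝ |
        p.1 ^ 2 + p.2.1 ^ 2 > (α₁ + p.2.2.1) ^ 2 + (α₂ + p.2.2.2) ^ 2})) =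
      ENNReal.ofReal (Real.exp (-(rj / σ ^ 2) * (α₁ + q.1) ^ 2)) *
        ENNReal.ofReal (Real.exp (-(rj / σ ^ 2) * (α₂ + q.2) ^ 2)) := by
    intro q
    have h := gaussianReal_prod_sq_add_sq_gt hj
      (show 0 ≤ (α₁ + q.1) ^ 2 + (α₂ + q.2) ^ 2 by positivity)
    rw [hjc, hsplit] at h
    exact h
  simp only [hinner]
  rw [lintegral_prod_mul (f := fun x => ENNReal.ofReal (Real.exp (-(rj / σ ^ 2) * (α₁ + x) ^ 2)))
      (g := fun x => ENNReal.ofReal (Real.exp (-(rj / σ ^ 2) * (α₂ + x) ^ 2)))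
      (by fun_prop) (by fun_prop),
    lintegral_exp_neg_mul_sq_gaussianReal hc hb, lintegral_exp_neg_mul_sq_gaussianReal hc hb,
    hcc, hd, ← ENNReal.ofReal_mul (by positivity), mul_mul_mul_comm, ← Real.exp_add, ← mul_inv,
    Real.mul_self_sqrt (by positivity), inv_div]
  congr 3
  field_simp
  ring
end

section
/- Let k > 1 and β > 0 be real numbers with β > k − 1. Set a₂ = β − k + 1, a₁ = (β − 2)(k − 1), a₀ = −(β + 1)k + 1, D = a₁² − 4 a₂ a₀, and x* = (−a₁ + √D)/(2 a₂). Then D > 0, x* > 1, h(x*) = 0 where h(x) = β (x + k)(x − 1) − (k − 1)(x + 1)², and x* is the global minimizer of p(x) = ((k + x)/(x + 1)) · exp( −β x/(x + 1)² ) over (0, ∞), i.e. p(x*) ≤ p(x) for all x > 0. -/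
/-- The derivative of `((k + x) / (x + 1)) exp(-β x / (x + 1)²)` is a positive multiple of
`β (x + k) (x - 1) - (k - 1) (x + 1)²`. -/
theorem hasDerivAt_div_mul_exp (k β x : ℝ) (hx : x + 1 ≠ 0) :
    HasDerivAt (fun x : ℝ => ((k + x) / (x + 1)) * Real.exp (-β * x / (x + 1) ^ 2))
      ((β * (x + k) * (x - 1) - (k - 1) * (x + 1) ^ 2) *
        (Real.exp (-β * x / (x + 1) ^ 2) / (x + 1) ^ 4)) x := by
  have hd : HasDerivAt (fun x : ℝ => x + 1) 1 x := (hasDerivAt_id x).add_const 1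
  have hf := ((hasDerivAt_id x).const_add k).div hd hx
  have hg := (((hasDerivAt_id x).const_mul (-β)).div (hd.pow 2) (pow_ne_zero 2 hx)).exp
  refine (hf.mul hg).congr_deriv ?_
  simp only [id, Pi.pow_apply, Pi.div_apply]
  field_simp
  ring

/-- A function on `(0, ∞)` whose derivative is nonpositive before `c` and nonnegative after `c`
attains its minimum at `c`. -/
theorem le_of_hasDerivAt_of_sign_change {f f' : ℝ → ℝ} {c : ℝ} (hc : 0 < c)
    (hf : ∀ x, 0 < x → HasDerivAt f (f' x) x) (hneg : ∀ x, 0 < x → x < c → f' x ≤ 0)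
    (hpos : ∀ x, c < x → 0 ≤ f' x) {x : ℝ} (hx : 0 < x) : f c ≤ f x := by
  rcases le_total x c with h | h
  · have hanti : AntitoneOn f (Set.Icc x c) := by
      refine antitoneOn_of_deriv_nonpos (convex_Icc x c)
        (fun y hy => (hf y (hx.trans_le hy.1)).continuousAt.continuousWithinAt) ?_ ?_
      all_goals
        rw [interior_Icc]
        intro y hy
        have hd := hf y (hx.trans hy.1)
      · exact hd.differentiableAt.differentiableWithinAt
      · exact hd.deriv ▸ hneg y (hx.trans hy.1) hy.2
    exact hanti (Set.left_mem_Icc.2 h) (Set.right_mem_Icc.2 h) h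
  · have hmono : MonotoneOn f (Set.Icc c x) := by
      refine monotoneOn_of_deriv_nonneg (convex_Icc c x)
        (fun y hy => (hf y (hc.trans_le hy.1)).continuousAt.continuousWithinAt) ?_ ?_
      all_goals
        rw [interior_Icc]
        intro y hy
        have hd := hf y (hc.trans hy.1)
      · exact hd.differentiableAt.differentiableWithinAt
      · exact hd.deriv ▸ hpos y hy.1
    exact hmono (Set.left_mem_Icc.2 h) (Set.right_mem_Icc.2 h) h

/-- Case (i) of Theorem 1 of the paper (`β > k − 1`): the root
`x* = (−a₁ + √D)/(2a₂)` of `h` exceeds 1 and is the global minimizer of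
`p(x) = ((k + x)/(x + 1)) exp(−β x/(x + 1)²)` over `(0, ∞)`. -/
theorem optimal_ratio_case_one (k β : ℝ) (hk : 1 < k) (hβ : 0 < β) (hβk : k - 1 < β) :
    let a₂ := β - k + 1
    let a₁ := (β - 2) * (k - 1)
    let a₀ := -(β + 1) * k + 1
    let D := a₁ ^ 2 - 4 * a₂ * a₀
    let xs := (-a₁ + Real.sqrt D) / (2 * a₂)
    0 < D ∧ 1 < xs ∧
    β * (xs + k) * (xs - 1) - (k - 1) * (xs + 1) ^ 2 = 0 ∧
    ∀ x : ℝ, 0 < x →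
      ((k + xs) / (xs + 1)) * Real.exp (-β * xs / (xs + 1) ^ 2) ≤
        ((k + x) / (x + 1)) * Real.exp (-β * x / (x + 1) ^ 2) := by
  intro a₂ a₁ a₀ D xs
  have ha₂ : 0 < a₂ := by linarith
  have ha₀ : a₀ < 0 := by
    simp only [a₀]
    nlinarith
  have hD : 0 < D := by
    simp only [D]
    nlinarith [mul_pos ha₂ (neg_pos.2 ha₀), sq_nonneg a₁]
  have hxs : 1 < xs := by
    rw [lt_div_iff₀ (by positivity)]
    have hsqrt : 2 * a₂ + a₁ < Real.sqrt D := by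
      apply Real.lt_sqrt_of_sq_lt
      have hdiff : D - (2 * a₂ + a₁) ^ 2 = 16 * (a₂ * (k - 1)) := by
        simp only [D, a₂, a₁, a₀]
        ring
      have : 0 < a₂ * (k - 1) := mul_pos ha₂ (by linarith)
      linarith
    linarith
  have hroot : a₂ * xs ^ 2 + a₁ * xs + a₀ = 0 := by
    have hlin : 2 * a₂ * xs + a₁ = Real.sqrt D := by
      simp only [xs]
      field_simp
      ring
    have hsq : (2 * a₂ * xs + a₁) ^ 2 = a₁ ^ 2 - 4 * a₂ * a₀ := by
      rw [hlin, Real.sq_sqrt hD.le]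
    have hmul : a₂ * (a₂ * xs ^ 2 + a₁ * xs + a₀) = 0 := by linear_combination hsq / 4
    exact (mul_eq_zero.1 hmul).resolve_left ha₂.ne'
  have hxs0 : 0 < xs := one_pos.trans hxs
  have hcoef : 0 < a₂ * xs + a₁ := by
    refine pos_of_mul_pos_left ?_ hxs0.le
    nlinarith
  have hfactor : ∀ x, β * (x + k) * (x - 1) - (k - 1) * (x + 1) ^ 2 =
      (x - xs) * (a₂ * x + (a₂ * xs + a₁)) := by
    intro x
    have hexpand : β * (x + k) * (x - 1) - (k - 1) * (x + 1) ^ 2 =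
        a₂ * x ^ 2 + a₁ * x + a₀ := by
      simp only [a₂, a₁, a₀]
      ring
    linear_combination hexpand + hroot
  refine ⟨hD, hxs, by rw [hfactor, sub_self, zero_mul], fun x hx => ?_⟩
  refine le_of_hasDerivAt_of_sign_change hxs0
    (fun y hy => hasDerivAt_div_mul_exp k β y (by positivity)) ?_ ?_ hx
  · intro y hy hyxs
    rw [hfactor]
    exact mul_nonpos_of_nonpos_of_nonneg
      (mul_nonpos_of_nonpos_of_nonneg (by linarith) (by positivity)) (by positivity)
  · intro y hy
    have hy0 : 0 < y := hxs0.trans hy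
    rw [hfactor]
    exact mul_nonneg (mul_nonneg (by linarith) (by positivity)) (by positivity)
end

section
/- Let k > 1 and β > 2 be real numbers with β = k − 1. Set a₁ = (β − 2)(k − 1), a₀ = −(β + 1)k + 1, and x* = −a₀/a₁. Then a₁ > 0, x* > 1, h(x*) = 0 where h(x) = β (x + k)(x − 1) − (k − 1)(x + 1)², and x* is the global minimizer of p(x) = ((k + x)/(x + 1)) · exp( −β x/(x + 1)² ) over (0, ∞), i.e. p(x*) ≤ p(x) for all x > 0. -/
open Set in
/-- For `c ≥ 1`, the function `s ↦ s * exp (-(s - 1) + (s - 1) ^ 2 / (2 * c))` attains its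
minimum over `[1, ∞)` at `c`. -/
theorem isMinOn_mul_exp_quadratic {c : ℝ} (hc : 1 ≤ c) :
    IsMinOn (fun s : ℝ => s * Real.exp (-(s - 1) + (s - 1) ^ 2 / (2 * c))) (Ici 1) c := by
  have hc0 : 0 < c := by linarith
  have hderiv (s : ℝ) : HasDerivAt (fun s : ℝ => s * Real.exp (-(s - 1) + (s - 1) ^ 2 / (2 * c)))
      (Real.exp (-(s - 1) + (s - 1) ^ 2 / (2 * c)) * ((s - 1) * (s - c) / c)) s := by
    have h := (hasDerivAt_id' s).sub_const 1
    refine ((hasDerivAt_id' s).mul (h.neg.add ((h.pow 2).div_const (2 * c))).exp).congr_deriv ?_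
    simp
    field_simp
    ring
  have hcont := continuous_iff_continuousAt.2 fun s => (hderiv s).continuousAt
  intro s (hs : 1 ≤ s)
  rcases le_total s c with hsc | hsc
  · refine antitoneOn_of_hasDerivWithinAt_nonpos (convex_Icc 1 c) hcont.continuousOn
      (fun t _ => (hderiv t).hasDerivWithinAt) ?_ ⟨hs, hsc⟩ ⟨hc, le_rfl⟩ hsc
    intro t ht
    rw [interior_Icc] at ht
    exact mul_nonpos_of_nonneg_of_nonpos (Real.exp_pos _).le (div_nonpos_of_nonpos_of_nonneg
      (mul_nonpos_of_nonneg_of_nonpos (by linarith [ht.1]) (by linarith [ht.2])) hc0.le)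
  · refine monotoneOn_of_hasDerivWithinAt_nonneg (convex_Ici c) hcont.continuousOn
      (fun t _ => (hderiv t).hasDerivWithinAt) ?_ self_mem_Ici hsc hsc
    intro t ht
    rw [interior_Ici] at ht
    have ht' : c < t := ht
    exact mul_nonneg (Real.exp_pos _).le (div_nonneg
      (mul_nonneg (by linarith) (by linarith)) hc0.le)

/-- Case (ii) of Theorem 1 of the paper (`β = k − 1`, `β > 2`): `h` is linear with
positive slope `a₁`, its root `x* = −a₀/a₁` exceeds 1 and is the global minimizer of
`p(x) = ((k + x)/(x + 1)) exp(−β x/(x + 1)²)` over `(0, ∞)`. -/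
theorem optimal_ratio_case_two (k β : ℝ) (hk : 1 < k) (hβ2 : 2 < β) (hβk : β = k - 1) :
    let a₁ := (β - 2) * (k - 1)
    let a₀ := -(β + 1) * k + 1
    let xs := -a₀ / a₁
    0 < a₁ ∧ 1 < xs ∧
    β * (xs + k) * (xs - 1) - (k - 1) * (xs + 1) ^ 2 = 0 ∧
    ∀ x : ℝ, 0 < x →
      ((k + xs) / (xs + 1)) * Real.exp (-β * xs / (xs + 1) ^ 2) ≤
        ((k + x) / (x + 1)) * Real.exp (-β * x / (x + 1) ^ 2) := by
  intro a₁ a₀ xs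
  obtain rfl : k = β + 1 := by linarith
  have hβ : 0 < β := by linarith
  have hβ' : 0 < β - 2 := by linarith
  have hxs : xs = (β + 2) / (β - 2) := by
    simp only [xs, a₀, a₁, add_sub_cancel_right]
    field_simp
    ring
  have hxs1 : 1 < xs := by
    rw [hxs, lt_div_iff₀ hβ']
    linarith
  refine ⟨by simp only [a₁, add_sub_cancel_right]; positivity, hxs1, ?_, fun x hx => ?_⟩
  · rw [hxs]
    field_simp
    ring
  · have hform (y : ℝ) (hy : 0 < y) : -β * y / (y + 1) ^ 2 =
        -((β + 1 + y) / (y + 1) - 1) + ((β + 1 + y) / (y + 1) - 1) ^ 2 / (2 * (β / 2)) := by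
      field_simp
      ring
    have hmin : (β + 1 + xs) / (xs + 1) = β / 2 := by
      rw [hxs]
      field_simp
      ring
    rw [hform xs (by linarith), hform x hx, hmin]
    refine isMinOn_mul_exp_quadratic (by linarith) (show 1 ≤ (β + 1 + x) / (x + 1) from ?_)
    rw [le_div_iff₀ (by linarith)]
    linarith
end

section
/- Let k > 1 and β be real numbers with 2 < β < k − 1. Set a₂ = β − k + 1, a₁ = (β − 2)(k − 1), a₀ = −(β + 1)k + 1, and D = a₁² − 4 a₂ a₀, and assume D > 0. Then a₂ < 0, and the two roots x₋ = (−a₁ + √D)/(2 a₂) and x₊ = (−a₁ − √D)/(2 a₂) of the quadratic h(x) = β (x + k)(x − 1) − (k − 1)(x + 1)² satisfy 1 < x₋ < x₊ and h(x₋) = h(x₊) = 0. Moreover, p(x) = ((k + x)/(x + 1)) · exp( −β x/(x + 1)² ) attains a local minimum at the smaller root x₋. -/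
/-- If the quadratic factor of the derivative splits as `a (x - r) (x - s)` with `a < 0` and
`-1 < r < s`, then the smaller root `r` is a local minimum. -/
theorem isLocalMin_div_mul_exp {k β a r s : ℝ} (ha : a < 0) (hr : -1 < r) (hrs : r < s)
    (hfac : ∀ x, β * (x + k) * (x - 1) - (k - 1) * (x + 1) ^ 2 = a * (x - r) * (x - s)) :
    IsLocalMin (fun x : ℝ => ((k + x) / (x + 1)) * Real.exp (-β * x / (x + 1) ^ 2)) r := by
  have hderiv (x : ℝ) (hx : -1 < x) :=
    hasDerivAt_div_mul_exp k β x (by linarith)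
  refine isLocalMin_of_deriv_Ioo hr hrs (hderiv r hr).continuousAt
    (fun x hx => (hderiv x hx.1).differentiableAt.differentiableWithinAt)
    (fun x hx => (hderiv x (hr.trans hx.1)).differentiableAt.differentiableWithinAt) ?_ ?_
  · intro x hx
    rw [(hderiv x hx.1).deriv, hfac]
    refine mul_nonpos_of_nonpos_of_nonneg ?_ (by positivity)
    exact mul_nonpos_of_nonneg_of_nonpos
      (mul_nonneg_of_nonpos_of_nonpos ha.le (by linarith [hx.2])) (by linarith [hx.2])
  · intro x hx
    rw [(hderiv x (hr.trans hx.1)).deriv, hfac]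
    refine mul_nonneg ?_ (by positivity)
    exact mul_nonneg_of_nonpos_of_nonpos
      (mul_nonpos_of_nonpos_of_nonneg ha.le (by linarith [hx.1])) (by linarith [hx.2])

/-- Under the discriminant condition, the vertex of the quadratic lies to the right of `1`. -/
theorem two_mul_lt_of_discrim_pos {k β : ℝ} (hβ2 : 2 < β) (hβk : β < k - 1)
    (hD : 0 < ((β - 2) * (k - 1)) ^ 2 - 4 * (β - k + 1) * (-(β + 1) * k + 1)) :
    2 * (k - 1 - β) < (β - 2) * (k - 1) := by
  obtain ⟨m, rfl⟩ : ∃ m, k = m + 1 := ⟨k - 1, by ring⟩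
  by_contra! hle
  have hD' : 0 < β * ((β - 8) * m ^ 2 + 4 * β * m + 4 * β) := by linarith
  have hpos := pos_of_mul_pos_right hD' (by linarith)
  have hm : 2 < m := by linarith
  have hmul : 0 ≤ m * ((4 - β) * m - 2 * β) := mul_nonneg (by linarith) (by linarith)
  have hsq : 0 < β * (m ^ 2 - 4) := mul_pos (by linarith) (by nlinarith)
  linarith


/-- Case (iii) of Theorem 1 of the paper (`2 < β < k − 1`, `D > 0`): `h` is a downward
quadratic (`a₂ < 0`) with two roots `1 < x₋ < x₊`, and
`p(x) = ((k + x)/(x + 1)) exp(−β x/(x + 1)²)` attains a local minimum at `x₋`. -/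
theorem optimal_ratio_case_three (k β : ℝ) (hk : 1 < k) (hβ2 : 2 < β) (hβk : β < k - 1)
    (hD : 0 < ((β - 2) * (k - 1)) ^ 2 - 4 * (β - k + 1) * (-(β + 1) * k + 1)) :
    let a₂ := β - k + 1
    let a₁ := (β - 2) * (k - 1)
    let a₀ := -(β + 1) * k + 1
    let D := a₁ ^ 2 - 4 * a₂ * a₀
    let xm := (-a₁ + Real.sqrt D) / (2 * a₂)
    let xp := (-a₁ - Real.sqrt D) / (2 * a₂)
    a₂ < 0 ∧ 1 < xm ∧ xm < xp ∧
    β * (xm + k) * (xm - 1) - (k - 1) * (xm + 1) ^ 2 = 0 ∧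
    β * (xp + k) * (xp - 1) - (k - 1) * (xp + 1) ^ 2 = 0 ∧
    IsLocalMin (fun x : ℝ => ((k + x) / (x + 1)) * Real.exp (-β * x / (x + 1) ^ 2)) xm := by
  intro a₂ a₁ a₀ D xm xp
  have ha : a₂ < 0 := by simp only [a₂]; linarith
  have hs : 0 < √D := Real.sqrt_pos.2 hD
  have hsq : √D ^ 2 = D := Real.sq_sqrt hD.le
  have hvertex : 0 < a₁ + 2 * a₂ := by
    have := two_mul_lt_of_discrim_pos hβ2 hβk hD
    simp only [a₁, a₂]; linarith
  have hone : a₂ + a₁ + a₀ < 0 := by simp only [a₂, a₁, a₀]; linarith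
  have hlt : √D < a₁ + 2 * a₂ := by
    refine lt_of_pow_lt_pow_left₀ 2 hvertex.le ?_
    have := mul_pos_of_neg_of_neg ha hone
    rw [hsq]
    simp only [D]
    linarith
  have h1 : 1 < xm := by
    rw [lt_div_iff_of_neg (by linarith)]
    linarith
  have h2 : xm < xp := div_lt_div_of_neg_of_lt (by linarith) (by linarith)
  have hfac (x : ℝ) :
      β * (x + k) * (x - 1) - (k - 1) * (x + 1) ^ 2 = a₂ * (x - xm) * (x - xp) := by
    have hsum : a₂ * (xm + xp) = -a₁ := by
      simp only [xm, xp]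
      field_simp [ha.ne]
      ring
    have hprod : a₂ * (xm * xp) = a₀ := by
      have : a₂ * (xm * xp) = (a₁ ^ 2 - √D ^ 2) / (4 * a₂) := by
        simp only [xm, xp]
        field_simp [ha.ne]
        ring
      rw [this, hsq, div_eq_iff (by linarith)]
      simp only [D]
      ring
    have : β * (x + k) * (x - 1) - (k - 1) * (x + 1) ^ 2 = a₂ * x ^ 2 + a₁ * x + a₀ := by
      simp only [a₂, a₁, a₀]
      ring
    linear_combination this + x * hsum - hprod
  exact ⟨ha, h1, h2, by rw [hfac]; ring, by rw [hfac]; ring,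
    isLocalMin_div_mul_exp ha (by linarith) h2 hfac⟩
end

section
/- Let k > 1 and β be real numbers with 0 < β ≤ k − 1, and suppose that either β ≤ 2 or D ≤ 0, where a₂ = β − k + 1, a₁ = (β − 2)(k − 1), a₀ = −(β + 1)k + 1, and D = a₁² − 4 a₂ a₀. Then h(x) = β (x + k)(x − 1) − (k − 1)(x + 1)² satisfies h(x) ≤ 0 for all x ≥ 0, and consequently p(x) = ((k + x)/(x + 1)) · exp( −β x/(x + 1)² ) is nonincreasing on [0, ∞). -/
/-- A real quadratic with negative constant term and nonpositive discriminant is nonpositive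
everywhere. -/
theorem quadratic_nonpos_of_discrim_nonpos {a b c : ℝ} (hc : c < 0)
    (hD : b ^ 2 - 4 * a * c ≤ 0) (x : ℝ) : a * x ^ 2 + b * x + c ≤ 0 := by
  by_contra! hx
  nlinarith [sq_nonneg (b * x + 2 * c), mul_nonneg (sq_nonneg x) (sub_nonneg.2 hD),
    mul_neg_of_neg_of_pos hc hx]

theorem hasDerivAt_ratio_mul_exp (k β : ℝ) {x : ℝ} (hx : x + 1 ≠ 0) :
    HasDerivAt (fun x : ℝ => ((k + x) / (x + 1)) * Real.exp (-β * x / (x + 1) ^ 2))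
      ((β * (x + k) * (x - 1) - (k - 1) * (x + 1) ^ 2) *
        (Real.exp (-β * x / (x + 1) ^ 2) / (x + 1) ^ 4)) x := by
  have h₁ : HasDerivAt (fun x : ℝ => x + 1) 1 x := (hasDerivAt_id x).add_const 1
  have h₂ : HasDerivAt (fun x : ℝ => k + x) 1 x := (hasDerivAt_id x).const_add k
  have h₃ : HasDerivAt (fun x : ℝ => -β * x) (-β * 1) x := (hasDerivAt_id x).const_mul (-β)
  refine ((h₂.fun_div h₁ hx).fun_mul (h₃.fun_div (h₁.fun_pow 2) (pow_ne_zero 2 hx)).exp).congr_deriv ?_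
  push_cast
  field_simp
  ring


/-- The remaining ("otherwise") case of Theorem 1 of the paper: if `0 < β ≤ k − 1` and
either `β ≤ 2` or `D ≤ 0`, then `h ≤ 0` on `[0, ∞)` and
`p(x) = ((k + x)/(x + 1)) exp(−β x/(x + 1)²)` is nonincreasing on `[0, ∞)`. -/
theorem optimal_ratio_case_otherwise (k β : ℝ) (hk : 1 < k) (hβ : 0 < β)
    (hβk : β ≤ k - 1)
    (hcase : β ≤ 2 ∨
      ((β - 2) * (k - 1)) ^ 2 - 4 * (β - k + 1) * (-(β + 1) * k + 1) ≤ 0) :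
    (∀ x : ℝ, 0 ≤ x →
        β * (x + k) * (x - 1) - (k - 1) * (x + 1) ^ 2 ≤ 0) ∧
    AntitoneOn (fun x : ℝ => ((k + x) / (x + 1)) * Real.exp (-β * x / (x + 1) ^ 2))
      (Set.Ici (0 : ℝ)) := by
  have hh : ∀ x : ℝ, 0 ≤ x → β * (x + k) * (x - 1) - (k - 1) * (x + 1) ^ 2 ≤ 0 := by
    intro x hx
    have ha : β - k + 1 ≤ 0 := by linarith
    have hc : -(β + 1) * k + 1 < 0 := by nlinarith
    suffices (β - k + 1) * x ^ 2 + (β - 2) * (k - 1) * x + (-(β + 1) * k + 1) ≤ 0 by linarith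
    rcases hcase with h | hD
    · have h₁ : (β - 2) * (k - 1) ≤ 0 :=
        mul_nonpos_of_nonpos_of_nonneg (by linarith) (by linarith)
      linarith [mul_nonpos_of_nonpos_of_nonneg ha (sq_nonneg x),
        mul_nonpos_of_nonpos_of_nonneg h₁ hx]
    · exact quadratic_nonpos_of_discrim_nonpos hc hD x
  have hd := fun (x : ℝ) (hx : 0 ≤ x) =>
    hasDerivAt_ratio_mul_exp k β (by linarith : 0 < x + 1).ne'
  refine ⟨hh, antitoneOn_of_hasDerivWithinAt_nonpos (convex_Ici 0)
    (fun x hx => (hd x hx).continuousAt.continuousWithinAt)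
    (fun x hx => (hd x (interior_subset hx)).hasDerivWithinAt) fun x hx => ?_⟩
  exact mul_nonpos_of_nonpos_of_nonneg (hh x (interior_subset hx)) (by positivity)
end

section
/- Let k > 1 and β > 0 be real numbers with β > k − 1, and let x* = (−a₁ + √D)/(2 a₂) with a₂ = β − k + 1, a₁ = (β − 2)(k − 1), a₀ = −(β + 1)k + 1, D = a₁² − 4 a₂ a₀. Then for any natural number R ≥ 2, the integer beam repetitions r₁ = ⌊R/(x* + 1)⌋ and r₂ = ⌊x* R/(x* + 1)⌋ satisfy r₁ ≤ r₂. -/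
/-- If a quadratic with positive leading coefficient is nonpositive at `1`, then its larger root
is at least `1`. -/
theorem one_le_larger_root {a b c : ℝ} (ha : 0 < a) (hsum : a + b + c ≤ 0) :
    1 ≤ (-b + Real.sqrt (b ^ 2 - 4 * a * c)) / (2 * a) := by
  have hsqrt : 2 * a + b ≤ Real.sqrt (b ^ 2 - 4 * a * c) :=
    Real.le_sqrt_of_sq_le (by nlinarith [mul_nonpos_of_nonneg_of_nonpos ha.le hsum])
  rw [le_div_iff₀ (by positivity)]
  linarith

/-- Corollary 1 of the paper: when `ĝ₁ > ĝ₂` (i.e. `k > 1`) and `β > k − 1`, the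
optimal beam-allocation ratio `x*` exceeds 1, so the floored integer allocation
`r₁ = ⌊R/(x* + 1)⌋`, `r₂ = ⌊x* R/(x* + 1)⌋` satisfies `r₁ ≤ r₂`. -/
theorem floored_allocation_ordered (k β : ℝ) (hk : 1 < k) (hβ : 0 < β)
    (hβk : k - 1 < β) (R : ℕ) (hR : 2 ≤ R) :
    let a₂ := β - k + 1
    let a₁ := (β - 2) * (k - 1)
    let a₀ := -(β + 1) * k + 1
    let D := a₁ ^ 2 - 4 * a₂ * a₀
    let xs := (-a₁ + Real.sqrt D) / (2 * a₂)
    ⌊(R : ℝ) / (xs + 1)⌋ ≤ ⌊xs * (R : ℝ) / (xs + 1)⌋ := by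
  intro a₂ a₁ a₀ D xs
  have ha₂ : 0 < a₂ := by simp only [a₂]; linarith
  have hsum : a₂ + a₁ + a₀ ≤ 0 := by simp only [a₂, a₁, a₀]; linarith
  have hxs : 1 ≤ xs := one_le_larger_root ha₂ hsum
  gcongr
  exact le_mul_of_one_le_left R.cast_nonneg hxs
end
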